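/- For every matrix Z in the subspace T (i.e., with P_T(Z) = Z), the Frobenius norm is controlled by the spectral norm via ‖Z‖_F ≤ √(2k)·‖Z‖. -/

import Mathlib

open Matrix BigOperators

/-- The operator `P_T(Z) = P_U Z + Z P_V - P_U Z P_V` with `P_U = U Uᵀ`, `P_V = V Vᵀ`. -/
noncomputable def PT {n k : ℕ} (U V : Matrix (Fin n) (Fin k) ℝ)
    (Z : Matrix (Fin n) (Fin n) ℝ) : Matrix (Fin n) (Fin n) ℝ :=
  U * Uᵀ * Z + Z * (V * Vᵀ) - U * Uᵀ * Z * (V * Vᵀ)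

/-- The spectral norm (ℓ2 operator norm) of a real square matrix. -/
noncomputable def specNorm {n : ℕ} (A : Matrix (Fin n) (Fin n) ℝ) : ℝ :=
  ‖Matrix.toEuclideanCLM (𝕜 := ℝ) A‖

/-- The Frobenius norm of a real square matrix. -/
noncomputable def frobNorm {n : ℕ} (A : Matrix (Fin n) (Fin n) ℝ) : ℝ :=
  Real.sqrt (∑ i, ∑ j, (A i j) ^ 2)

theorem specNorm_transpose {n : ℕ} (A : Matrix (Fin n) (Fin n) ℝ) :
    specNorm Aᵀ = specNorm A := by
  unfold specNorm
  rw [← conjTranspose_eq_transpose_of_trivial, ← star_eq_conjTranspose, map_star,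
    ContinuousLinearMap.star_eq_adjoint]
  exact LinearIsometryEquiv.norm_map _ _

theorem trace_transpose_mul_self_eq_sum_sq {m n : ℕ} (A : Matrix (Fin m) (Fin n) ℝ) :
    (Aᵀ * A).trace = ∑ j, ∑ i, A i j ^ 2 := by
  simp [trace, mul_apply, sq]

theorem trace_transpose_mul_self_nonneg {m n : ℕ} (A : Matrix (Fin m) (Fin n) ℝ) :
    0 ≤ (Aᵀ * A).trace := by
  rw [trace_transpose_mul_self_eq_sum_sq]
  positivity

theorem sum_sq_mulVec_le {n : ℕ} (A : Matrix (Fin n) (Fin n) ℝ) (x : Fin n → ℝ) :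
    ∑ i, (A *ᵥ x) i ^ 2 ≤ specNorm A ^ 2 * ∑ i, x i ^ 2 := by
  have h := (toEuclideanCLM (𝕜 := ℝ) A).le_opNorm (WithLp.toLp 2 x)
  have h₂ := pow_le_pow_left₀ (norm_nonneg _) h 2
  rw [mul_pow, EuclideanSpace.real_norm_sq_eq, EuclideanSpace.real_norm_sq_eq] at h₂
  simpa [specNorm] using h₂

/-- The squared Frobenius norm of `A * W`, where `W` has `k` orthonormal columns, is at most
`k` times the squared spectral norm of `A`. -/
theorem trace_transpose_mul_self_mul_le {n k : ℕ} (A : Matrix (Fin n) (Fin n) ℝ)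
    (W : Matrix (Fin n) (Fin k) ℝ) (hW : Wᵀ * W = 1) :
    ((A * W)ᵀ * (A * W)).trace ≤ k * specNorm A ^ 2 := by
  rw [trace_transpose_mul_self_eq_sum_sq]
  have hcol (j : Fin k) : ∑ i, (A * W) i j ^ 2 ≤ specNorm A ^ 2 := by
    have hunit : ∑ i, W i j ^ 2 = 1 := by
      simpa [mul_apply, sq] using congrFun₂ hW j j
    have h := sum_sq_mulVec_le A (fun i => W i j)
    rw [hunit, mul_one] at h
    exact h
  simpa using Finset.sum_le_sum fun j (_ : j ∈ Finset.univ) => hcol j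

/-- On the range of `PT`, the squared Frobenius norm is given by inclusion-exclusion. -/
theorem trace_transpose_mul_self_of_PT_eq {n k : ℕ} {U V : Matrix (Fin n) (Fin k) ℝ}
    {Z : Matrix (Fin n) (Fin n) ℝ} (hZ : PT U V Z = Z) :
    (Zᵀ * Z).trace = ((Zᵀ * U)ᵀ * (Zᵀ * U)).trace + ((Z * V)ᵀ * (Z * V)).trace
      - ((Uᵀ * Z * V)ᵀ * (Uᵀ * Z * V)).trace := by
  have hU : ((Zᵀ * U)ᵀ * (Zᵀ * U)).trace = (Zᵀ * (U * Uᵀ * Z)).trace := by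
    rw [trace_mul_comm]
    simp [Matrix.mul_assoc]
  have hV : ((Z * V)ᵀ * (Z * V)).trace = (Zᵀ * (Z * (V * Vᵀ))).trace := by
    rw [transpose_mul, Matrix.mul_assoc, trace_mul_comm]
    simp only [Matrix.mul_assoc]
  have hUV : ((Uᵀ * Z * V)ᵀ * (Uᵀ * Z * V)).trace
      = (Zᵀ * (U * Uᵀ * Z * (V * Vᵀ))).trace := by
    rw [transpose_mul, Matrix.mul_assoc, trace_mul_comm]
    simp [Matrix.mul_assoc]
  rw [hU, hV, hUV, ← trace_add, ← trace_sub, ← Matrix.mul_add, ← Matrix.mul_sub]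
  exact congrArg (fun X => (Zᵀ * X).trace) hZ.symm

/-- for every `Z ∈ T`, `‖Z‖_F ≤ √(2k) · ‖Z‖`. -/
theorem frobNorm_le_sqrt_two_k_mul_specNorm (n k : ℕ) (hk : 1 ≤ k) (hkn : k ≤ n)
    (U V : Matrix (Fin n) (Fin k) ℝ)
    (hU : Uᵀ * U = (1 : Matrix (Fin k) (Fin k) ℝ))
    (hV : Vᵀ * V = (1 : Matrix (Fin k) (Fin k) ℝ))
    (Z : Matrix (Fin n) (Fin n) ℝ) (hZ : PT U V Z = Z) :
    frobNorm Z ≤ Real.sqrt (2 * k) * specNorm Z := by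
  have hUle := trace_transpose_mul_self_mul_le Zᵀ U hU
  rw [specNorm_transpose] at hUle
  have hVle := trace_transpose_mul_self_mul_le Z V hV
  have hUV := trace_transpose_mul_self_nonneg (Uᵀ * Z * V)
  have hsq : ∑ i, ∑ j, Z i j ^ 2 ≤ 2 * k * specNorm Z ^ 2 := by
    rw [Finset.sum_comm, ← trace_transpose_mul_self_eq_sum_sq,
      trace_transpose_mul_self_of_PT_eq hZ]
    linarith
  have hnonneg : 0 ≤ specNorm Z := norm_nonneg _
  calc frobNorm Z ≤ √(2 * k * specNorm Z ^ 2) := Real.sqrt_le_sqrt hsq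
    _ = √(2 * k) * specNorm Z := by
      rw [Real.sqrt_mul (by positivity), Real.sqrt_sq hnonneg]
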